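/- arXiv:1310.8498 — 2 statements merged into one kernel-verified Lean document; each statement's English description precedes it below -/
import Mathlib

section
/- Let N ≥ 1 be an integer and let ρ_N be the unscaled GUE eigenvalue density. Then for every real t, ∫_ℝ e^{t·x}·ρ_N(x) dx = N·e^{−t²/2}·Σ_{k=0}^{∞} ( (N+1)_k / ((k+1)!·k!) )·t^{2k}, where (a)_k = a·(a+1)⋯(a+k−1) denotes the Pochhammer symbol; that is, the exponential generating function of the GUE moments equals N·e^{−t²/2}·₁F₁(1+N, 2; t²). -/
open Nat MeasureTheory

/-- The orthonormal Hermite functions' polynomial part: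
`p_n(x) = He_n(x)/√(√(2π)·n!)`, orthonormal for the weight `e^{-x²/2}` on `ℝ`. -/
noncomputable def pOrtho (n : ℕ) (x : ℝ) : ℝ :=
  Polynomial.aeval x (Polynomial.hermite n) /
    Real.sqrt (Real.sqrt (2 * Real.pi) * (n ! : ℝ))

/-- The (unscaled) GUE eigenvalue density
`ρ_N(x) = √N · e^{-x²/2} · (p_N'(x)p_{N-1}(x) − p_N(x)p_{N-1}'(x))`. -/
noncomputable def gueDensity (N : ℕ) (x : ℝ) : ℝ :=
  Real.sqrt N * Real.exp (-x ^ 2 / 2) *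
    (deriv (pOrtho N) x * pOrtho (N - 1) x - pOrtho N x * deriv (pOrtho (N - 1)) x)

open Polynomial in
/-- The Hermite polynomial `He_n` over `ℝ`. -/
noncomputable def realHermite (n : ℕ) : ℝ[X] := (hermite n).map (Int.castRingHom ℝ)

section Hermite

open Polynomial

lemma realHermite_zero : realHermite 0 = 1 := by simp [realHermite]

lemma realHermite_succ (n : ℕ) :
    realHermite (n + 1) = X * realHermite n - derivative (realHermite n) := by
  simp [realHermite, hermite_succ, derivative_map]

lemma derivative_realHermite_succ (n : ℕ) :
    derivative (realHermite (n + 1)) = (n + 1 : ℝ[X]) * realHermite n := by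
  induction n with
  | zero => simp [realHermite_succ, realHermite_zero]
  | succ n ih =>
    rw [realHermite_succ (n + 1), derivative_sub, derivative_mul, derivative_X, ih,
      derivative_mul]
    simp only [derivative_add, derivative_natCast, derivative_one]
    rw [realHermite_succ n]
    push_cast
    ring

lemma iterate_derivative_realHermite (n k : ℕ) :
    derivative^[k] (realHermite (n + k)) = C ((n + k).descFactorial k : ℝ) * realHermite n := by
  induction k with
  | zero => simp
  | succ k ih =>
    rw [Function.iterate_succ_apply, ← add_assoc, derivative_realHermite_succ,
      show ((↑(n + k) + 1 : ℝ[X])) = C ((n + k : ℕ) + 1 : ℝ) by simp,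
      iterate_derivative_C_mul, ih, Nat.succ_descFactorial_succ]
    push_cast
    rw [C_mul]
    ring

lemma aeval_hermite_eq_eval_realHermite (n : ℕ) (x : ℝ) :
    aeval x (hermite n) = (realHermite n).eval x := by
  rw [realHermite, eval_map, aeval_def]; rfl

end Hermite

section GaussianFunctional

open Polynomial ProbabilityTheory

lemma integrable_eval_mul_exp_gaussianReal (t : ℝ) (q : ℝ[X]) :
    Integrable (fun x ↦ q.eval x * Real.exp (t * x)) (gaussianReal 0 1) := by
  induction q using Polynomial.induction_on' with
  | add p q hp hq =>
    simp only [eval_add, add_mul]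
    exact hp.add hq
  | monomial n a =>
    simp only [eval_monomial, mul_assoc]
    refine Integrable.const_mul ?_ a
    exact integrable_pow_mul_exp_of_mem_interior_integrableExpSet (X := id)
      (by simp [integrableExpSet_id_gaussianReal]) n

/-- The functional `q ↦ E[q(Z) e^{tZ}]` for a standard Gaussian `Z`. -/
noncomputable def tiltedGaussian (t : ℝ) : ℝ[X] →ₗ[ℝ] ℝ where
  toFun q := ∫ x, q.eval x * Real.exp (t * x) ∂gaussianReal 0 1
  map_add' p q := by
    simp only [eval_add, add_mul]
    exact integral_add (integrable_eval_mul_exp_gaussianReal t p)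
      (integrable_eval_mul_exp_gaussianReal t q)
  map_smul' a q := by
    simp [mul_assoc, integral_const_mul]

lemma tiltedGaussian_apply (t : ℝ) (q : ℝ[X]) :
    tiltedGaussian t q = ∫ x, gaussianPDFReal 0 1 x * (q.eval x * Real.exp (t * x)) := by
  change ∫ x, q.eval x * Real.exp (t * x) ∂gaussianReal 0 1 = _
  rw [integral_gaussianReal_eq_integral_smul one_ne_zero]
  rfl

lemma integrable_gaussianPDFReal_mul_eval_mul_exp (t : ℝ) (q : ℝ[X]) :
    Integrable (fun x ↦ gaussianPDFReal 0 1 x * (q.eval x * Real.exp (t * x))) := by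
  have h := integrable_eval_mul_exp_gaussianReal t q
  rw [gaussianReal_of_var_ne_zero _ one_ne_zero,
    integrable_withDensity_iff_integrable_smul' (measurable_gaussianPDF _ _)
      (by simp [gaussianPDF])] at h
  simpa [toReal_gaussianPDF] using h

lemma hasDerivAt_gaussianPDFReal (x : ℝ) :
    HasDerivAt (gaussianPDFReal 0 1) (-x * gaussianPDFReal 0 1 x) x := by
  have h : HasDerivAt (fun x : ℝ ↦ -(x - 0) ^ 2 / (2 * ((1 : NNReal) : ℝ))) (-x) x := by
    have := ((((hasDerivAt_id x).sub_const 0).pow 2).neg).div_const (2 * ((1 : NNReal) : ℝ))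
    exact this.congr_deriv (by simp; ring)
  rw [gaussianPDFReal_def]
  exact (h.exp.const_mul (√(2 * Real.pi * ((1 : NNReal) : ℝ)))⁻¹).congr_deriv (by ring)

lemma tiltedGaussian_X_mul (t : ℝ) (q : ℝ[X]) :
    tiltedGaussian t (X * q) = tiltedGaussian t (t • q + derivative q) := by
  rw [← sub_eq_zero, ← map_sub, ← neg_eq_zero, ← map_neg, tiltedGaussian_apply]
  refine integral_eq_zero_of_hasDerivAt_of_integrable (fun x ↦ ?_)
    (integrable_gaussianPDFReal_mul_eval_mul_exp t _)
    (integrable_gaussianPDFReal_mul_eval_mul_exp t q)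
  have he : HasDerivAt (fun x ↦ Real.exp (t * x)) (Real.exp (t * x) * t) x := by
    simpa using ((hasDerivAt_id x).const_mul t).exp
  refine ((hasDerivAt_gaussianPDFReal x).mul ((q.hasDerivAt x).mul he)).congr_deriv ?_
  simp
  ring

lemma tiltedGaussian_one (t : ℝ) : tiltedGaussian t 1 = Real.exp (t ^ 2 / 2) := by
  have h := congrFun (mgf_id_gaussianReal (μ := 0) (v := 1)) t
  simp only [mgf, id] at h
  change ∫ x, (1 : ℝ[X]).eval x * Real.exp (t * x) ∂gaussianReal 0 1 = _
  simpa using h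

lemma tiltedGaussian_realHermite_mul (t : ℝ) (n : ℕ) (q : ℝ[X]) :
    tiltedGaussian t (realHermite n * q) =
      tiltedGaussian t (((derivative + t • 1 : Module.End ℝ ℝ[X]) ^ n) q) := by
  induction n generalizing q with
  | zero => simp [realHermite_zero]
  | succ n ih =>
    rw [pow_succ, Module.End.mul_apply, ← ih, realHermite_succ, sub_mul, mul_assoc, map_sub,
      tiltedGaussian_X_mul, ← map_sub]
    congr 1
    simp only [derivative_mul, LinearMap.add_apply, LinearMap.smul_apply, Module.End.one_apply,
      mul_add, mul_smul_comm]
    ring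

lemma tiltedGaussian_realHermite (t : ℝ) (n : ℕ) :
    tiltedGaussian t (realHermite n) = t ^ n * Real.exp (t ^ 2 / 2) := by
  have h : ∀ n : ℕ, ((derivative + t • 1 : Module.End ℝ ℝ[X]) ^ n) 1 = t ^ n • 1 := by
    intro n
    induction n with
    | zero => simp
    | succ n ih =>
      rw [_root_.pow_succ', Module.End.mul_apply, ih]
      simp [smul_smul, pow_succ]
  rw [← mul_one (realHermite n), tiltedGaussian_realHermite_mul, h, map_smul, tiltedGaussian_one,
    smul_eq_mul]

lemma tiltedGaussian_realHermite_sq (t : ℝ) (n : ℕ) :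
    tiltedGaussian t (realHermite n * realHermite n) = (n ! : ℝ) * Real.exp (t ^ 2 / 2) *
      ∑ i ∈ Finset.range (n + 1), (n.choose i : ℝ) * ((t ^ 2) ^ i / (i ! : ℝ)) := by
  have hc : Commute (derivative : Module.End ℝ ℝ[X]) (t • 1) :=
    (Commute.one_right _).smul_right t
  rw [tiltedGaussian_realHermite_mul, hc.add_pow, LinearMap.sum_apply, map_sum,
    ← Finset.sum_range_reflect, Finset.mul_sum]
  refine Finset.sum_congr rfl fun i hi ↦ ?_
  obtain ⟨k, rfl⟩ := Nat.exists_eq_add_of_le (Nat.lt_succ_iff.mp (Finset.mem_range.mp hi))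
  rw [show i + k + 1 - 1 - i = k by omega, show i + k - k = i by omega, _root_.smul_pow, one_pow,
    mul_smul_comm, mul_one, smul_mul_assoc, ← Nat.cast_comm, ← nsmul_eq_mul,
    LinearMap.smul_apply, LinearMap.smul_apply, Module.End.pow_apply,
    iterate_derivative_realHermite, ← smul_eq_C_mul, map_smul, map_nsmul, map_smul,
    tiltedGaussian_realHermite, Nat.choose_symm_add]
  have hf : (i ! : ℝ) * ((i + k).descFactorial k : ℝ) = ((i + k)! : ℝ) := by
    have := Nat.factorial_mul_descFactorial (Nat.le_add_left k i)
    rw [Nat.add_sub_cancel] at this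
    exact_mod_cast this
  have hi0 : (i ! : ℝ) ≠ 0 := by positivity
  rw [← hf]
  simp only [smul_eq_mul, nsmul_eq_mul]
  field_simp
  ring

end GaussianFunctional

section Density

open Polynomial ProbabilityTheory

/-- The Wronskian `He_n He_{n+1}' − He_{n+1} He_n'`. -/
noncomputable def hermiteWronskian (n : ℕ) : ℝ[X] :=
  derivative (realHermite (n + 1)) * realHermite n -
    realHermite (n + 1) * derivative (realHermite n)

lemma hermiteWronskian_zero : hermiteWronskian 0 = 1 := by
  simp [hermiteWronskian, realHermite_succ, realHermite_zero]

lemma hermiteWronskian_succ (n : ℕ) :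
    hermiteWronskian (n + 1) = ((n + 1 : ℕ) : ℝ) • hermiteWronskian n +
      realHermite (n + 1) * realHermite (n + 1) := by
  rw [hermiteWronskian, hermiteWronskian, realHermite_succ (n + 1), derivative_sub,
    derivative_mul, derivative_realHermite_succ, derivative_mul, smul_eq_C_mul]
  simp only [derivative_add, derivative_natCast, derivative_one, derivative_X]
  push_cast
  simp only [C_add, C_1, map_natCast]
  ring

lemma tiltedGaussian_hermiteWronskian (t : ℝ) (n : ℕ) :
    tiltedGaussian t (hermiteWronskian n) = (n ! : ℝ) * Real.exp (t ^ 2 / 2) *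
      ∑ i ∈ Finset.range (n + 1), ((n + 1).choose (i + 1) : ℝ) * ((t ^ 2) ^ i / (i ! : ℝ)) := by
  induction n with
  | zero => simp [hermiteWronskian_zero, tiltedGaussian_one]
  | succ n ih =>
    rw [hermiteWronskian_succ, map_add, map_smul, ih, tiltedGaussian_realHermite_sq]
    have h : ∑ i ∈ Finset.range (n + 1), ((n + 1).choose (i + 1) : ℝ) * ((t ^ 2) ^ i / (i ! : ℝ)) =
        ∑ i ∈ Finset.range (n + 1 + 1),
          ((n + 1).choose (i + 1) : ℝ) * ((t ^ 2) ^ i / (i ! : ℝ)) := by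
      rw [Finset.sum_range_succ _ (n + 1)]
      simp
    rw [h, Nat.factorial_succ, smul_eq_mul, Nat.cast_mul, ← mul_assoc, ← mul_assoc, ← mul_add,
      ← Finset.sum_add_distrib]
    congr 1
    refine Finset.sum_congr rfl fun i _ ↦ ?_
    rw [Nat.choose_succ_succ (n + 1) i]
    push_cast
    ring

lemma pOrtho_eq (n : ℕ) :
    pOrtho n = fun x ↦ (realHermite n).eval x / √(√(2 * Real.pi) * (n ! : ℝ)) := by
  funext x
  rw [pOrtho, aeval_hermite_eq_eval_realHermite]

lemma deriv_pOrtho (n : ℕ) (x : ℝ) :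
    deriv (pOrtho n) x =
      (derivative (realHermite n)).eval x / √(√(2 * Real.pi) * (n ! : ℝ)) := by
  rw [pOrtho_eq, deriv_div_const, Polynomial.deriv]

lemma gueDensity_succ (n : ℕ) (x : ℝ) :
    gueDensity (n + 1) x =
      (n ! : ℝ)⁻¹ * (gaussianPDFReal 0 1 x * (hermiteWronskian n).eval x) := by
  have hs : √(√(2 * Real.pi) * ((n + 1)! : ℝ)) =
      √((n + 1 : ℕ) : ℝ) * √(√(2 * Real.pi) * (n ! : ℝ)) := by
    rw [← Real.sqrt_mul (by positivity), Nat.factorial_succ]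
    congr 1
    push_cast
    ring
  have hq : √(√(2 * Real.pi) * (n ! : ℝ)) ^ 2 = √(2 * Real.pi) * (n ! : ℝ) :=
    Real.sq_sqrt (by positivity)
  have hN : √((n + 1 : ℕ) : ℝ) ≠ 0 := by positivity
  have hc : √(√(2 * Real.pi) * (n ! : ℝ)) ≠ 0 := by positivity
  have hp : √(2 * Real.pi) ≠ 0 := by positivity
  have hf : (n ! : ℝ) ≠ 0 := by positivity
  have hinv : (n ! : ℝ)⁻¹ * (√(2 * Real.pi))⁻¹ = (√(√(2 * Real.pi) * (n ! : ℝ)) ^ 2)⁻¹ := by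
    rw [hq, mul_inv, mul_comm]
  have hw : gaussianPDFReal 0 1 x = (√(2 * Real.pi))⁻¹ * Real.exp (-x ^ 2 / 2) := by
    simp [gaussianPDFReal]
  rw [hw, mul_assoc, ← mul_assoc, hinv, gueDensity, Nat.add_sub_cancel, deriv_pOrtho,
    deriv_pOrtho, pOrtho_eq, pOrtho_eq, hs, hermiteWronskian, eval_sub, eval_mul, eval_mul]
  field_simp

lemma integral_exp_mul_gueDensity_succ (n : ℕ) (t : ℝ) :
    ∫ x : ℝ, Real.exp (t * x) * gueDensity (n + 1) x = Real.exp (t ^ 2 / 2) *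
      ∑ i ∈ Finset.range (n + 1), ((n + 1).choose (i + 1) : ℝ) * ((t ^ 2) ^ i / (i ! : ℝ)) := by
  have h : ∀ x : ℝ, Real.exp (t * x) * gueDensity (n + 1) x = (n ! : ℝ)⁻¹ *
      (gaussianPDFReal 0 1 x * ((hermiteWronskian n).eval x * Real.exp (t * x))) := by
    intro x
    rw [gueDensity_succ]
    ring
  have hf : (n ! : ℝ) ≠ 0 := by positivity
  simp_rw [h]
  rw [integral_const_mul, ← tiltedGaussian_apply, tiltedGaussian_hermiteWronskian]
  field_simp

end Density

section Kummer

lemma sum_antidiagonal_choose_succ_mul_choose (N k : ℕ) :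
    ∑ p ∈ Finset.HasAntidiagonal.antidiagonal k, N.choose (p.1 + 1) * k.choose p.2 =
      (N + k).choose (k + 1) := by
  rw [Nat.add_choose_eq, Finset.Nat.sum_antidiagonal_succ]
  simp

lemma mul_ascPochhammer_eval_div_factorial (N k : ℕ) :
    (N : ℝ) * ((ascPochhammer ℝ k).eval ((N : ℝ) + 1) / (((k + 1)! : ℝ) * (k ! : ℝ))) =
      ((N + k).choose (k + 1) : ℝ) / (k ! : ℝ) := by
  have h : N * (N + 1).ascFactorial k = (k + 1)! * (N + k).choose (k + 1) := by
    rw [Nat.succ_ascFactorial, ← Nat.ascFactorial_succ, Nat.ascFactorial_eq_factorial_mul_choose']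
    rfl
  have hk : ((k + 1)! : ℝ) ≠ 0 := by positivity
  have hk' : (k ! : ℝ) ≠ 0 := by positivity
  rw [show (N : ℝ) + 1 = ((N + 1 : ℕ) : ℝ) by push_cast; rfl,
    ascPochhammer_nat_eq_natCast_ascFactorial]
  field_simp
  exact_mod_cast h

/-- Kummer's transformation for `₁F₁(N + 1, 2; s)`. -/
lemma exp_mul_sum_choose_eq_tsum (N : ℕ) (s : ℝ) :
    Real.exp s * ∑ i ∈ Finset.range N, (N.choose (i + 1) : ℝ) * (s ^ i / (i ! : ℝ)) =
      N * ∑' k : ℕ, (ascPochhammer ℝ k).eval ((N : ℝ) + 1) / (((k + 1)! : ℝ) * (k ! : ℝ)) *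
        s ^ k := by
  have hz : ∀ i ∉ Finset.range N, (N.choose (i + 1) : ℝ) * (s ^ i / (i ! : ℝ)) = 0 := by
    intro i hi
    rw [Nat.choose_eq_zero_of_lt (by simpa [Nat.lt_succ_iff] using hi)]
    simp
  have hsum : Summable fun i : ℕ ↦ ‖(N.choose (i + 1) : ℝ) * (s ^ i / (i ! : ℝ))‖ :=
    summable_of_ne_finset_zero (s := Finset.range N) fun i hi ↦ by rw [hz i hi, norm_zero]
  rw [← tsum_eq_sum (L := .unconditional ℕ) hz, Real.exp_eq_exp_ℝ, NormedSpace.exp_eq_tsum_div, mul_comm,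
    tsum_mul_tsum_eq_tsum_sum_antidiagonal_of_summable_norm hsum
      (NormedSpace.norm_expSeries_div_summable s), ← tsum_mul_left]
  refine tsum_congr fun k ↦ ?_
  rw [← mul_assoc, mul_ascPochhammer_eval_div_factorial,
    ← sum_antidiagonal_choose_succ_mul_choose, Nat.cast_sum, Finset.sum_div, Finset.sum_mul]
  refine Finset.sum_congr rfl fun p hp ↦ ?_
  obtain ⟨i, j⟩ := p
  obtain rfl : i + j = k := Finset.HasAntidiagonal.mem_antidiagonal.mp hp
  have hc : ((i + j).choose j : ℝ) * (i ! : ℝ) * (j ! : ℝ) = ((i + j)! : ℝ) := by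
    exact_mod_cast Nat.add_choose_mul_factorial_mul_factorial i j
  have hij : ((i + j)! : ℝ) ≠ 0 := by positivity
  have hi : (i ! : ℝ) ≠ 0 := by positivity
  have hj : (j ! : ℝ) ≠ 0 := by positivity
  push_cast
  field_simp
  rw [← hc]
  ring

end Kummer

/-- The exponential generating function of the GUE moments equals
`N·e^{−t²/2}·₁F₁(1+N, 2; t²)`, where the confluent hypergeometric function is
given by its power series with Pochhammer coefficients. -/
theorem gueEGF_hypergeometric (N : ℕ) (hN : 1 ≤ N) (t : ℝ) :
    ∫ x : ℝ, Real.exp (t * x) * gueDensity N x =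
      (N : ℝ) * Real.exp (-t ^ 2 / 2) *
        ∑' k : ℕ,
          (ascPochhammer ℝ k).eval ((N : ℝ) + 1) / (((k + 1)! : ℝ) * (k ! : ℝ)) *
            t ^ (2 * k) := by
  obtain ⟨n, rfl⟩ := Nat.exists_eq_add_of_le' hN
  simp_rw [pow_mul]
  rw [mul_comm ((n + 1 : ℕ) : ℝ), mul_assoc, ← exp_mul_sum_choose_eq_tsum,
    integral_exp_mul_gueDensity_succ, ← mul_assoc, ← Real.exp_add]
  congr 2
  ring
end

section
/- Let N ≥ 2 be an integer, let ρ_N be the unscaled GOE eigenvalue density, and define u(t) = ∫_ℝ e^{t·x}·ρ_N(x) dx (the integral converges for every real t). Then u is smooth and satisfies, for every real t, the fourth order linear differential equation t·u''''(t) + 5·u'''(t) − t·(5t² + 8N − 4)·u''(t) − (36t² + 20N − 10)·u'(t) + t·(4t⁴ + (20N−10)·t² + 16N² − 16N − 44)·u(t) = 0. -/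
open Nat MeasureTheory

/-- `q_n(x) = ∫_{−∞}^{x} e^{−t²/4} p_n(t) dt`. -/
noncomputable def qFun (n : ℕ) (x : ℝ) : ℝ :=
  ∫ t in Set.Iic x, Real.exp (-t ^ 2 / 4) * pOrtho n t

/-- `D_n = π^{1/4} 2^{3/4} √((n−1)!!/n!!)`. -/
noncomputable def Dconst (n : ℕ) : ℝ :=
  Real.pi ^ ((1 : ℝ) / 4) * (2 : ℝ) ^ ((3 : ℝ) / 4) *
    Real.sqrt ((Nat.doubleFactorial (n - 1) : ℝ) / (Nat.doubleFactorial n : ℝ))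

/-- `A_N = −(1/4)D_N` for even `N`, and `A_N = N^{−1/2} D_{N−1}^{−1}` for odd `N`. -/
noncomputable def Aconst (N : ℕ) : ℝ :=
  if N % 2 = 0 then -(1 / 4) * Dconst N else (Real.sqrt N)⁻¹ * (Dconst (N - 1))⁻¹

/-- The (unscaled) GOE eigenvalue density
`ρ_N(x) = √N·(e^{−x²/2}(p_N'p_{N−1} − p_N p_{N−1}') + e^{−x²/4}((1/2)q_N + A_N)p_{N−1})`. -/
noncomputable def goeDensity (N : ℕ) (x : ℝ) : ℝ :=
  Real.sqrt N *
    (Real.exp (-x ^ 2 / 2) *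
        (deriv (pOrtho N) x * pOrtho (N - 1) x - pOrtho N x * deriv (pOrtho (N - 1)) x) +
      Real.exp (-x ^ 2 / 4) * ((1 / 2) * qFun N x + Aconst N) * pOrtho (N - 1) x)

/-- The exponential generating function `u(t) = ∫_ℝ e^{tx} ρ_N(x) dx` of the
GOE moments. -/
noncomputable def goeEGF (N : ℕ) (t : ℝ) : ℝ :=
  ∫ x : ℝ, Real.exp (t * x) * goeDensity N x

/-- Functions bounded by an exponential. -/
def ExpGrowth (f : ℝ → ℝ) : Prop :=
  Continuous f ∧ ∃ C c : ℝ, ∀ x, |f x| ≤ C * Real.exp (c * |x|)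

/-- Functions decaying faster than every exponential. -/
def RapidDecay (f : ℝ → ℝ) : Prop :=
  Continuous f ∧ ∀ c : ℝ, ∃ C : ℝ, ∀ x, |f x| ≤ C * Real.exp (-(c * |x|))

namespace ExpGrowth

lemma of_bounded {f : ℝ → ℝ} (hf : Continuous f) (C : ℝ) (h : ∀ x, |f x| ≤ C) :
    ExpGrowth f :=
  ⟨hf, C, 0, fun x => by simpa using h x⟩

lemma const (a : ℝ) : ExpGrowth (fun _ => a) :=
  of_bounded continuous_const |a| fun _ => le_rfl

lemma id : ExpGrowth (fun x => x) :=
  ⟨continuous_id, 1, 1, fun x => by linarith [Real.add_one_le_exp (1 * |x|)]⟩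

lemma mul {f g : ℝ → ℝ} (hf : ExpGrowth f) (hg : ExpGrowth g) :
    ExpGrowth (fun x => f x * g x) := by
  obtain ⟨hfc, C, c, hC⟩ := hf
  obtain ⟨hgc, D, d, hD⟩ := hg
  refine ⟨hfc.mul hgc, C * D, c + d, fun x => ?_⟩
  rw [abs_mul, add_mul, Real.exp_add]
  calc |f x| * |g x| ≤ (C * Real.exp (c * |x|)) * (D * Real.exp (d * |x|)) :=
        mul_le_mul (hC x) (hD x) (abs_nonneg _) ((abs_nonneg _).trans (hC x))
    _ = _ := by ring

lemma add {f g : ℝ → ℝ} (hf : ExpGrowth f) (hg : ExpGrowth g) :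
    ExpGrowth (fun x => f x + g x) := by
  obtain ⟨hfc, C, c, hC⟩ := hf
  obtain ⟨hgc, D, d, hD⟩ := hg
  have key : ∀ (K k e : ℝ), k ≤ e → ∀ x : ℝ,
      K * Real.exp (k * |x|) ≤ |K| * Real.exp (e * |x|) := fun K k e h x =>
    mul_le_mul (le_abs_self K)
      (Real.exp_le_exp.2 (mul_le_mul_of_nonneg_right h (abs_nonneg x)))
      (Real.exp_pos _).le (abs_nonneg K)
  refine ⟨hfc.add hgc, |C| + |D|, max c d, fun x => ?_⟩
  have h1 := key C c _ (le_max_left c d) x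
  have h2 := key D d _ (le_max_right c d) x
  linarith [abs_add_le (f x) (g x), hC x, hD x]

lemma pow {f : ℝ → ℝ} (hf : ExpGrowth f) (n : ℕ) : ExpGrowth (fun x => f x ^ n) := by
  induction n with
  | zero => simpa using const 1
  | succ n ih => simpa only [pow_succ] using ih.mul hf

lemma aeval (p : Polynomial ℤ) : ExpGrowth (fun x => Polynomial.aeval x p) := by
  induction p using Polynomial.induction_on' with
  | add p q hp hq => simpa using hp.add hq
  | monomial n a => simpa [Polynomial.aeval_monomial] using (const (a : ℝ)).mul (id.pow n)

end ExpGrowth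

lemma integrable_exp_neg_abs_real : Integrable (fun x : ℝ => Real.exp (-|x|)) := by
  refine (integrable_inv_one_add_sq.const_mul 2).mono' (by fun_prop) (.of_forall fun x => ?_)
  have h := Real.quadratic_le_exp_of_nonneg (abs_nonneg x)
  rw [sq_abs] at h
  rw [Real.norm_of_nonneg (Real.exp_pos _).le, Real.exp_neg, ← div_eq_mul_inv,
    inv_eq_one_div, div_le_div_iff₀ (Real.exp_pos _) (by positivity)]
  linarith [abs_nonneg x]

namespace RapidDecay

lemma mul {f g : ℝ → ℝ} (hf : ExpGrowth f) (hg : RapidDecay g) :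
    RapidDecay (fun x => f x * g x) := by
  obtain ⟨hfc, C, c, hC⟩ := hf
  obtain ⟨hgc, hg⟩ := hg
  refine ⟨hfc.mul hgc, fun d => ?_⟩
  obtain ⟨D, hD⟩ := hg (c + d)
  refine ⟨C * D, fun x => ?_⟩
  rw [abs_mul]
  calc |f x| * |g x| ≤ (C * Real.exp (c * |x|)) * (D * Real.exp (-((c + d) * |x|))) :=
        mul_le_mul (hC x) (hD x) (abs_nonneg _) ((abs_nonneg _).trans (hC x))
    _ = C * D * (Real.exp (c * |x|) * Real.exp (-((c + d) * |x|))) := by ring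
    _ = _ := by rw [← Real.exp_add]; ring_nf

lemma add {f g : ℝ → ℝ} (hf : RapidDecay f) (hg : RapidDecay g) :
    RapidDecay (fun x => f x + g x) := by
  refine ⟨hf.1.add hg.1, fun c => ?_⟩
  obtain ⟨C, hC⟩ := hf.2 c
  obtain ⟨D, hD⟩ := hg.2 c
  exact ⟨C + D, fun x => by linarith [abs_add_le (f x) (g x), hC x, hD x]⟩

lemma expGrowth {f : ℝ → ℝ} (hf : RapidDecay f) : ExpGrowth f := by
  obtain ⟨C, hC⟩ := hf.2 0
  exact ⟨hf.1, C, 0, fun x => by simpa using hC x⟩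

lemma const_mul {f : ℝ → ℝ} (hf : RapidDecay f) (a : ℝ) : RapidDecay (fun x => a * f x) :=
  mul (.const a) hf

lemma pow_mul {f : ℝ → ℝ} (hf : RapidDecay f) (k : ℕ) : RapidDecay (fun x => x ^ k * f x) :=
  mul (ExpGrowth.id.pow k) hf

lemma gaussian : RapidDecay (fun x => Real.exp (-x ^ 2 / 4)) := by
  refine ⟨by fun_prop, fun c => ⟨Real.exp (c ^ 2), fun x => ?_⟩⟩
  rw [abs_of_pos (Real.exp_pos _), ← Real.exp_add, Real.exp_le_exp]
  nlinarith [sq_nonneg (|x| / 2 - c), sq_abs x]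

lemma exp_mul_le {f : ℝ → ℝ} (hf : RapidDecay f) (c : ℝ) :
    ∃ C : ℝ, ∀ t x : ℝ, |t| ≤ c → |Real.exp (t * x) * f x| ≤ C * Real.exp (-|x|) := by
  obtain ⟨C, hC⟩ := hf.2 (c + 1)
  have hC0 : 0 ≤ C := by simpa using (abs_nonneg _).trans (hC 0)
  refine ⟨C, fun t x ht => ?_⟩
  rw [abs_mul, abs_of_pos (Real.exp_pos _)]
  calc Real.exp (t * x) * |f x| ≤ Real.exp (t * x) * (C * Real.exp (-((c + 1) * |x|))) :=
        mul_le_mul_of_nonneg_left (hC x) (Real.exp_pos _).le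
    _ = C * Real.exp (t * x + -((c + 1) * |x|)) := by rw [Real.exp_add]; ring
    _ ≤ C * Real.exp (-|x|) := by
        refine mul_le_mul_of_nonneg_left (Real.exp_le_exp.2 ?_) hC0
        have h1 : t * x ≤ |t| * |x| := (le_abs_self _).trans (abs_mul t x).le
        have h2 : |t| * |x| ≤ c * |x| := mul_le_mul_of_nonneg_right ht (abs_nonneg x)
        linarith

lemma integrable_exp_mul {f : ℝ → ℝ} (hf : RapidDecay f) (t : ℝ) :
    Integrable (fun x => Real.exp (t * x) * f x) := by
  obtain ⟨C, hC⟩ := hf.exp_mul_le |t|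
  have hfc := hf.1
  exact (integrable_exp_neg_abs_real.const_mul C).mono' (by fun_prop)
    (.of_forall fun x => hC t x le_rfl)

lemma integrable {f : ℝ → ℝ} (hf : RapidDecay f) : Integrable f := by
  simpa using hf.integrable_exp_mul 0

end RapidDecay

/-- The two-sided Laplace transform `t ↦ ∫ e^{tx} f(x) dx`. -/
noncomputable def bilateralLaplace (f : ℝ → ℝ) (t : ℝ) : ℝ :=
  ∫ x : ℝ, Real.exp (t * x) * f x

lemma bilateralLaplace_add {f g : ℝ → ℝ} (hf : RapidDecay f) (hg : RapidDecay g) (t : ℝ) :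
    bilateralLaplace (fun x => f x + g x) t = bilateralLaplace f t + bilateralLaplace g t := by
  simp only [bilateralLaplace, mul_add]
  exact integral_add (hf.integrable_exp_mul t) (hg.integrable_exp_mul t)

lemma bilateralLaplace_const_mul (a : ℝ) (f : ℝ → ℝ) (t : ℝ) :
    bilateralLaplace (fun x => a * f x) t = a * bilateralLaplace f t := by
  simp only [bilateralLaplace, mul_left_comm _ a]
  exact integral_const_mul a _

lemma bilateralLaplace_deriv {f f' : ℝ → ℝ} (hf : RapidDecay f) (hf' : RapidDecay f')
    (h : ∀ x, HasDerivAt f (f' x) x) (t : ℝ) :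
    bilateralLaplace f' t = -(t * bilateralLaplace f t) := by
  have hd : ∀ x, HasDerivAt (fun x => Real.exp (t * x) * f x)
      (t * (Real.exp (t * x) * f x) + Real.exp (t * x) * f' x) x := fun x => by
    refine ((((hasDerivAt_id x).const_mul t).exp).mul (h x)).congr_deriv ?_
    simp only [id]
    ring
  have h0 := integral_eq_zero_of_hasDerivAt_of_integrable hd
    (((hf.integrable_exp_mul t).const_mul t).add (hf'.integrable_exp_mul t))
    (hf.integrable_exp_mul t)
  rw [integral_add ((hf.integrable_exp_mul t).const_mul t) (hf'.integrable_exp_mul t),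
    integral_const_mul] at h0
  simp only [bilateralLaplace]
  linarith

lemma hasDerivAt_bilateralLaplace {f : ℝ → ℝ} (hf : RapidDecay f) (t : ℝ) :
    HasDerivAt (bilateralLaplace f) (bilateralLaplace (fun x => x * f x) t) t := by
  have hxf : RapidDecay (fun x => x * f x) := .mul .id hf
  obtain ⟨C, hC⟩ := hxf.exp_mul_le (|t| + 1)
  have hfc := hf.1
  refine (hasDerivAt_integral_of_dominated_loc_of_deriv_le
    (F := fun t x => Real.exp (t * x) * f x)
    (F' := fun t x => Real.exp (t * x) * (x * f x))
    (bound := fun x => C * Real.exp (-|x|))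
    (Metric.ball_mem_nhds t one_pos)
    (.of_forall fun _ => by fun_prop) (hf.integrable_exp_mul t) (by fun_prop)
    (.of_forall fun x s hs => hC s x ?_) (integrable_exp_neg_abs_real.const_mul C)
    (.of_forall fun x s _ => ?_)).2
  · rw [Metric.mem_ball, Real.dist_eq] at hs
    have := abs_add_le (s - t) t
    rw [sub_add_cancel] at this
    linarith
  · refine ((((hasDerivAt_id s).mul_const x).exp).mul_const (f x)).congr_deriv ?_
    simp only [id]
    ring

lemma iteratedDeriv_bilateralLaplace {f : ℝ → ℝ} (hf : RapidDecay f) (k : ℕ) :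
    iteratedDeriv k (bilateralLaplace f) = bilateralLaplace (fun x => x ^ k * f x) := by
  induction k with
  | zero => simp
  | succ k ih =>
    rw [iteratedDeriv_succ, ih]
    funext t
    rw [(hasDerivAt_bilateralLaplace (hf.pow_mul k) t).deriv]
    congr 1
    funext x
    ring

lemma contDiff_bilateralLaplace {f : ℝ → ℝ} (hf : RapidDecay f) :
    ContDiff ℝ (⊤ : ℕ∞) (bilateralLaplace f) := by
  refine contDiff_of_differentiable_iteratedDeriv fun k _ => ?_
  rw [iteratedDeriv_bilateralLaplace hf]
  exact fun t => (hasDerivAt_bilateralLaplace (hf.pow_mul k) t).differentiableAt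

/-- The transform of a solution of `g''' - (x² - a) g' + 3 x g = 0` satisfies
`t y'' + 5 y' - t (t² + a) y = 0`. -/
lemma bilateralLaplace_second_order {g g₁ g₂ g₃ : ℝ → ℝ} (a : ℝ)
    (hg : RapidDecay g) (hg₁ : RapidDecay g₁) (hg₂ : RapidDecay g₂) (hg₃ : RapidDecay g₃)
    (h₀ : ∀ x, HasDerivAt g (g₁ x) x) (h₁ : ∀ x, HasDerivAt g₁ (g₂ x) x)
    (h₂ : ∀ x, HasDerivAt g₂ (g₃ x) x)
    (hode : ∀ x, g₃ x - (x ^ 2 - a) * g₁ x + 3 * x * g x = 0) (t : ℝ) :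
    t * bilateralLaplace (fun x => x ^ 2 * g x) t + 5 * bilateralLaplace (fun x => x * g x) t
      - t * (t ^ 2 + a) * bilateralLaplace g t = 0 := by
  have hxg : RapidDecay (fun x => x * g x) := .mul .id hg
  have e₁ := bilateralLaplace_deriv hg hg₁ h₀ t
  have e₂ := bilateralLaplace_deriv hg₁ hg₂ h₁ t
  have e₃ := bilateralLaplace_deriv hg₂ hg₃ h₂ t
  have hsq : ∀ x, HasDerivAt (fun x => x ^ 2 * g x)
      (5 * (x * g x) + (a * g₁ x + g₃ x)) x := fun x => by
    refine ((hasDerivAt_pow 2 x).mul (h₀ x)).congr_deriv ?_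
    simp
    linear_combination -hode x
  have e₄ := bilateralLaplace_deriv (hg.pow_mul 2)
    ((hxg.const_mul 5).add ((hg₁.const_mul a).add hg₃)) hsq t
  rw [bilateralLaplace_add (hxg.const_mul 5) ((hg₁.const_mul a).add hg₃),
    bilateralLaplace_add (hg₁.const_mul a) hg₃, bilateralLaplace_const_mul,
    bilateralLaplace_const_mul] at e₄
  linear_combination e₄ - e₃ + t * e₂ - (t ^ 2 + a) * e₁

/-- If `g = x² f - 4 f'' - a f` solves `g''' - (x² - a) g' + 3 x g = 0`, then the transform of `f`
solves a fourth order equation. -/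
lemma bilateralLaplace_fourth_order {f f₁ f₂ g₁ g₂ g₃ : ℝ → ℝ} (a : ℝ)
    (hf : RapidDecay f) (hf₁ : RapidDecay f₁) (hf₂ : RapidDecay f₂)
    (hg₁ : RapidDecay g₁) (hg₂ : RapidDecay g₂) (hg₃ : RapidDecay g₃)
    (h₀ : ∀ x, HasDerivAt f (f₁ x) x) (h₁ : ∀ x, HasDerivAt f₁ (f₂ x) x)
    (k₀ : ∀ x, HasDerivAt (fun x => x ^ 2 * f x + (-4 * f₂ x + -a * f x)) (g₁ x) x)
    (k₁ : ∀ x, HasDerivAt g₁ (g₂ x) x) (k₂ : ∀ x, HasDerivAt g₂ (g₃ x) x)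
    (hode : ∀ x, g₃ x - (x ^ 2 - a) * g₁ x
      + 3 * x * (x ^ 2 * f x + (-4 * f₂ x + -a * f x)) = 0) (t : ℝ) :
    t * iteratedDeriv 4 (bilateralLaplace f) t + 5 * iteratedDeriv 3 (bilateralLaplace f) t -
      t * (5 * t ^ 2 + 2 * a) * iteratedDeriv 2 (bilateralLaplace f) t -
      (36 * t ^ 2 + 5 * a) * deriv (bilateralLaplace f) t +
      t * (4 * t ^ 4 + 5 * a * t ^ 2 + a ^ 2 - 48) * bilateralLaplace f t = 0 := by
  set g : ℝ → ℝ := fun x => x ^ 2 * f x + (-4 * f₂ x + -a * f x) with hgdef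
  have hg : RapidDecay g := (hf.pow_mul 2).add ((hf₂.const_mul (-4)).add (hf.const_mul (-a)))
  have hxg : RapidDecay (fun x => x * g x) := .mul .id hg
  have hdf : ∀ (k : ℕ) (t : ℝ), HasDerivAt (bilateralLaplace (fun x => x ^ k * f x))
      (bilateralLaplace (fun x => x ^ (k + 1) * f x) t) t := fun k t => by
    convert hasDerivAt_bilateralLaplace (hf.pow_mul k) t using 2
    funext x
    ring
  have hdf₀ : ∀ t : ℝ, HasDerivAt (bilateralLaplace f)
      (bilateralLaplace (fun x => x ^ 1 * f x) t) t := fun t => by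
    simpa using hdf 0 t
  have y₀ : bilateralLaplace g = fun t => bilateralLaplace (fun x => x ^ 2 * f x) t
      - (4 * t ^ 2 + a) * bilateralLaplace f t := by
    funext t
    rw [hgdef, bilateralLaplace_add (hf.pow_mul 2) ((hf₂.const_mul (-4)).add (hf.const_mul (-a))),
      bilateralLaplace_add (hf₂.const_mul (-4)) (hf.const_mul (-a)), bilateralLaplace_const_mul,
      bilateralLaplace_const_mul, bilateralLaplace_deriv hf₁ hf₂ h₁,
      bilateralLaplace_deriv hf hf₁ h₀]
    ring
  have hq : ∀ t : ℝ, HasDerivAt (fun t : ℝ => 4 * t ^ 2 + a) (8 * t) t := fun t => by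
    refine (((hasDerivAt_pow 2 t).const_mul 4).add_const a).congr_deriv ?_
    simp
    ring
  have y₁ : bilateralLaplace (fun x => x * g x) =
      fun t => bilateralLaplace (fun x => x ^ 3 * f x) t
      - (8 * t * bilateralLaplace f t
        + (4 * t ^ 2 + a) * bilateralLaplace (fun x => x ^ 1 * f x) t) := by
    funext t
    have h := hasDerivAt_bilateralLaplace hg t
    rw [y₀] at h
    exact h.unique ((hdf 2 t).sub ((hq t).mul (hdf₀ t)))
  have y₂ : bilateralLaplace (fun x => x ^ 2 * g x) t =
      bilateralLaplace (fun x => x ^ 4 * f x) t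
      - ((8 * bilateralLaplace f t + 8 * t * bilateralLaplace (fun x => x ^ 1 * f x) t)
        + (8 * t * bilateralLaplace (fun x => x ^ 1 * f x) t
        + (4 * t ^ 2 + a) * bilateralLaplace (fun x => x ^ 2 * f x) t)) := by
    have h := hasDerivAt_bilateralLaplace hxg t
    rw [y₁] at h
    have hlin : HasDerivAt (fun t : ℝ => 8 * t) 8 t := by
      simpa using (hasDerivAt_id t).const_mul 8
    rw [← h.unique ((hdf 3 t).sub ((hlin.mul (hdf₀ t)).add ((hq t).mul (hdf 1 t))))]
    congr 1
    funext x
    ring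
  have key := bilateralLaplace_second_order a hg hg₁ hg₂ hg₃ k₀ k₁ k₂ hode t
  rw [y₂, y₁, y₀] at key
  rw [(hdf₀ t).deriv]
  simp only [iteratedDeriv_bilateralLaplace hf]
  linear_combination key

/-- The form of the density in terms of the two top wave functions `A`, `B` and a primitive `Q` of
`A / 2`. -/
def densityForm (s : ℝ) (A B Q : ℝ → ℝ) (x : ℝ) : ℝ :=
  s * (s * (A x * A x) + s * (B x * B x) + -1 * (x * (A x * B x)) + Q x * B x)

section WaveFunctions

variable {s : ℝ} {A B Q : ℝ → ℝ}

lemma rapidDecay_densityForm (hA : RapidDecay A) (hB : RapidDecay B) (hQ : ExpGrowth Q) :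
    RapidDecay (densityForm s A B Q) :=
  .const_mul (((((RapidDecay.mul hA.expGrowth hA).const_mul s).add
    ((RapidDecay.mul hB.expGrowth hB).const_mul s)).add
    ((RapidDecay.mul .id (.mul hA.expGrowth hB)).const_mul (-1))).add (.mul hQ hB)) s

lemma bilateralLaplace_densityForm_ode (hA : RapidDecay A) (hB : RapidDecay B) (hQ : ExpGrowth Q)
    (dA : ∀ x, HasDerivAt A (s * B x - x / 2 * A x) x)
    (dB : ∀ x, HasDerivAt B (x / 2 * B x - s * A x) x)
    (dQ : ∀ x, HasDerivAt Q (A x / 2) x) (t : ℝ) :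
    let u := bilateralLaplace (densityForm s A B Q)
    let a := 4 * s ^ 2 - 2
    t * iteratedDeriv 4 u t + 5 * iteratedDeriv 3 u t -
      t * (5 * t ^ 2 + 2 * a) * iteratedDeriv 2 u t -
      (36 * t ^ 2 + 5 * a) * deriv u t +
      t * (4 * t ^ 4 + 5 * a * t ^ 2 + a ^ 2 - 48) * u t = 0 := by
  have hAA := RapidDecay.mul hA.expGrowth hA
  have hBB := RapidDecay.mul hB.expGrowth hB
  have hAB := RapidDecay.mul hA.expGrowth hB
  have dX : ∀ x : ℝ, HasDerivAt (fun x : ℝ => x) 1 x := hasDerivAt_id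
  have dAA := fun x => (dA x).mul (dA x)
  have dBB := fun x => (dB x).mul (dB x)
  have dAB := fun x => (dA x).mul (dB x)
  refine bilateralLaplace_fourth_order (4 * s ^ 2 - 2)
    (f₁ := fun x => s * (-(1 / 2) * (A x * B x)
      + (1 / 2 * (x * (Q x * B x)) + -s * (Q x * A x))))
    (f₂ := fun x => s * (-(s / 2) * (B x * B x) + 1 / 4 * (x * (A x * B x))
      + ((1 / 2 - s ^ 2) * (Q x * B x) + 1 / 4 * (x ^ 2 * (Q x * B x)))))
    (g₁ := fun x => s * (3 * s * (x * (A x * A x)) + 3 * s * (x * (B x * B x))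
      + -3 * (x ^ 2 * (A x * B x)) + -3 * (A x * B x)))
    (g₂ := fun x => s * (6 * s * (A x * A x) + -6 * (x * (A x * B x))))
    (g₃ := fun x => s * (-6 * s * (x * (B x * B x)) + (12 * s ^ 2 - 6) * (A x * B x)))
    (rapidDecay_densityForm hA hB hQ) ?_ ?_ ?_ ?_ ?_ (fun x => ?_) (fun x => ?_) (fun x => ?_)
    (fun x => ?_) (fun x => ?_) (fun x => ?_) t
  · exact .const_mul ((hAB.const_mul _).add (((RapidDecay.mul .id (.mul hQ hB)).const_mul _).add
      ((RapidDecay.mul hQ hA).const_mul _))) s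
  · exact .const_mul (((hBB.const_mul _).add ((RapidDecay.mul .id hAB).const_mul _)).add
      (((RapidDecay.mul hQ hB).const_mul _).add
        (((RapidDecay.mul hQ hB).pow_mul 2).const_mul _))) s
  · exact .const_mul (((((RapidDecay.mul .id hAA).const_mul _).add
      ((RapidDecay.mul .id hBB).const_mul _)).add ((hAB.pow_mul 2).const_mul _)).add
      (hAB.const_mul _)) s
  · exact .const_mul ((hAA.const_mul _).add ((RapidDecay.mul .id hAB).const_mul _)) s
  · exact .const_mul (((RapidDecay.mul .id hBB).const_mul _).add (hAB.const_mul _)) s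
  · refine (((((((dAA x).const_mul s).add ((dBB x).const_mul s)).add
      (((dX x).mul (dAB x)).const_mul (-1))).add ((dQ x).mul (dB x))).const_mul s)).congr_deriv ?_
    simp only [Pi.mul_apply]
    ring
  · refine ((((dAB x).const_mul (-(1 / 2))).add
      ((((dX x).mul ((dQ x).mul (dB x))).const_mul (1 / 2)).add
        (((dQ x).mul (dA x)).const_mul (-s)))).const_mul s).congr_deriv ?_
    simp only [Pi.mul_apply]
    ring
  · have hg : (fun x => x ^ 2 * densityForm s A B Q x
        + (-4 * (s * (-(s / 2) * (B x * B x) + 1 / 4 * (x * (A x * B x))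
          + ((1 / 2 - s ^ 2) * (Q x * B x) + 1 / 4 * (x ^ 2 * (Q x * B x)))))
        + -(4 * s ^ 2 - 2) * densityForm s A B Q x)) =
        fun x => s * (s * ((x ^ 2 - (4 * s ^ 2 - 2)) * (A x * A x))
          + s * ((x ^ 2 - (4 * s ^ 2 - 4)) * (B x * B x))
          + ((4 * s ^ 2 - 3) * (x * (A x * B x)) - x ^ 3 * (A x * B x))) := by
      funext x
      simp only [densityForm]
      ring
    rw [hg]
    refine ((((((((dX x).pow 2).sub_const (4 * s ^ 2 - 2)).mul (dAA x)).const_mul s).add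
      (((((dX x).pow 2).sub_const (4 * s ^ 2 - 4)).mul (dBB x)).const_mul s)).add
      ((((dX x).mul (dAB x)).const_mul (4 * s ^ 2 - 3)).sub
        (((dX x).pow 3).mul (dAB x)))).const_mul s).congr_deriv ?_
    simp only [Pi.mul_apply, Pi.pow_apply, Nat.cast_ofNat, Nat.reduceSub]
    ring
  · refine (((((((dX x).mul (dAA x)).const_mul (3 * s)).add
      (((dX x).mul (dBB x)).const_mul (3 * s))).add
      ((((dX x).pow 2).mul (dAB x)).const_mul (-3))).add
      ((dAB x).const_mul (-3))).const_mul s).congr_deriv ?_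
    simp only [Pi.mul_apply, Pi.pow_apply, Nat.cast_ofNat, Nat.reduceSub]
    ring
  · refine ((((dAA x).const_mul (6 * s)).add
      (((dX x).mul (dAB x)).const_mul (-6))).const_mul s).congr_deriv ?_
    simp only [Pi.mul_apply]
    ring
  · simp only [densityForm]
    ring

end WaveFunctions

lemma Polynomial.derivative_hermite_succ (n : ℕ) :
    derivative (hermite (n + 1)) = (n + 1 : Polynomial ℤ) * hermite n := by
  induction n with
  | zero => simp
  | succ n ih =>
    rw [hermite_succ (n + 1), derivative_sub, derivative_mul, derivative_X, ih, derivative_mul,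
      show derivative ((n : Polynomial ℤ) + 1) = 0 by simp, hermite_succ n]
    push_cast
    ring

lemma normalization_succ (n : ℕ) :
    Real.sqrt (Real.sqrt (2 * Real.pi) * ((n + 1) ! : ℝ)) =
      Real.sqrt ((n + 1 : ℕ) : ℝ) * Real.sqrt (Real.sqrt (2 * Real.pi) * (n ! : ℝ)) := by
  rw [← Real.sqrt_mul (by positivity)]
  congr 1
  rw [Nat.factorial_succ]
  push_cast
  ring

lemma hasDerivAt_pOrtho_succ (n : ℕ) (x : ℝ) :
    HasDerivAt (pOrtho (n + 1)) (Real.sqrt ((n + 1 : ℕ) : ℝ) * pOrtho n x) x := by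
  have h := ((Polynomial.hermite (n + 1)).hasDerivAt_aeval x).div_const
    (Real.sqrt (Real.sqrt (2 * Real.pi) * ((n + 1) ! : ℝ)))
  refine h.congr_deriv ?_
  have hs : Real.sqrt ((n + 1 : ℕ) : ℝ) ≠ 0 := (Real.sqrt_pos.2 (by positivity)).ne'
  have hc : Real.sqrt (Real.sqrt (2 * Real.pi) * (n ! : ℝ)) ≠ 0 :=
    (Real.sqrt_pos.2 (by positivity)).ne'
  rw [Polynomial.derivative_hermite_succ, normalization_succ, pOrtho]
  have hsq := Real.mul_self_sqrt (Nat.cast_nonneg (α := ℝ) (n + 1))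
  simp only [map_mul, map_add, map_natCast, map_one]
  rw [← mul_div_assoc, div_eq_div_iff (mul_ne_zero hs hc) hc]
  push_cast at hsq ⊢
  linear_combination (Polynomial.aeval x (Polynomial.hermite n) *
    Real.sqrt (Real.sqrt (2 * Real.pi) * (n ! : ℝ))) * -hsq

lemma hasDerivAt_pOrtho (n : ℕ) (x : ℝ) :
    HasDerivAt (pOrtho n)
      (x * pOrtho n x - Real.sqrt ((n + 1 : ℕ) : ℝ) * pOrtho (n + 1) x) x := by
  have h := ((Polynomial.hermite n).hasDerivAt_aeval x).div_const
    (Real.sqrt (Real.sqrt (2 * Real.pi) * (n ! : ℝ)))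
  refine h.congr_deriv ?_
  have hs : Real.sqrt ((n + 1 : ℕ) : ℝ) ≠ 0 := (Real.sqrt_pos.2 (by positivity)).ne'
  have hc : Real.sqrt (Real.sqrt (2 * Real.pi) * (n ! : ℝ)) ≠ 0 :=
    (Real.sqrt_pos.2 (by positivity)).ne'
  rw [pOrtho, pOrtho, normalization_succ, Polynomial.hermite_succ]
  simp only [map_sub, map_mul, Polynomial.aeval_X]
  field_simp
  ring

/-- The wave function `e^{-x²/4} p_n(x)`. -/
noncomputable def waveFun (n : ℕ) (x : ℝ) : ℝ :=
  Real.exp (-x ^ 2 / 4) * pOrtho n x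

lemma hasDerivAt_gaussian (x : ℝ) :
    HasDerivAt (fun x : ℝ => Real.exp (-x ^ 2 / 4)) (-(x / 2) * Real.exp (-x ^ 2 / 4)) x := by
  refine ((((hasDerivAt_pow 2 x).neg).div_const 4).exp).congr_deriv ?_
  simp
  ring

lemma hasDerivAt_waveFun_succ (n : ℕ) (x : ℝ) :
    HasDerivAt (waveFun (n + 1))
      (Real.sqrt ((n + 1 : ℕ) : ℝ) * waveFun n x - x / 2 * waveFun (n + 1) x) x := by
  refine ((hasDerivAt_gaussian x).mul (hasDerivAt_pOrtho_succ n x)).congr_deriv ?_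
  simp only [waveFun]
  ring

lemma hasDerivAt_waveFun (n : ℕ) (x : ℝ) :
    HasDerivAt (waveFun n)
      (x / 2 * waveFun n x - Real.sqrt ((n + 1 : ℕ) : ℝ) * waveFun (n + 1) x) x := by
  refine ((hasDerivAt_gaussian x).mul (hasDerivAt_pOrtho n x)).congr_deriv ?_
  simp only [waveFun]
  ring

lemma rapidDecay_waveFun (n : ℕ) : RapidDecay (waveFun n) := by
  have h := RapidDecay.mul
    ((ExpGrowth.aeval (Polynomial.hermite n)).mul
      (.const (Real.sqrt (Real.sqrt (2 * Real.pi) * (n ! : ℝ)))⁻¹)) RapidDecay.gaussian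
  convert h using 1
  funext x
  simp only [waveFun, pOrtho, div_eq_mul_inv]
  ring

lemma hasDerivAt_qFun (n : ℕ) (x : ℝ) : HasDerivAt (qFun n) (waveFun n x) x := by
  have hw := rapidDecay_waveFun n
  have hi := hw.integrable
  have h : qFun n =
      fun x => (∫ t in Set.Iic (0 : ℝ), waveFun n t) + ∫ t in (0 : ℝ)..x, waveFun n t := by
    funext x
    rw [← intervalIntegral.integral_Iic_sub_Iic hi.integrableOn hi.integrableOn]
    simp only [qFun, waveFun]
    ring
  rw [h]
  exact (intervalIntegral.integral_hasDerivAt_right hi.intervalIntegrable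
    (hw.1.stronglyMeasurableAtFilter _ _) hw.1.continuousAt).const_add _

lemma abs_qFun_le (n : ℕ) (x : ℝ) : |qFun n x| ≤ ∫ t, |waveFun n t| :=
  (norm_integral_le_integral_norm _).trans
    (setIntegral_le_integral (rapidDecay_waveFun n).integrable.norm
      (.of_forall fun _ => norm_nonneg _))

lemma continuous_qFun (n : ℕ) : Continuous (qFun n) :=
  continuous_iff_continuousAt.2 fun x => (hasDerivAt_qFun n x).continuousAt

lemma goeDensity_succ (n : ℕ) :
    goeDensity (n + 1) = densityForm (Real.sqrt ((n + 1 : ℕ) : ℝ)) (waveFun (n + 1)) (waveFun n)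
      (fun x => 1 / 2 * qFun (n + 1) x + Aconst (n + 1)) := by
  funext x
  have he : Real.exp (-x ^ 2 / 2) = Real.exp (-x ^ 2 / 4) * Real.exp (-x ^ 2 / 4) := by
    rw [← Real.exp_add]
    ring_nf
  simp only [goeDensity, densityForm, Nat.add_sub_cancel, (hasDerivAt_pOrtho_succ n x).deriv,
    (hasDerivAt_pOrtho n x).deriv, he, waveFun]
  ring

/-- The GOE exponential generating function is well defined (the integral
converges for every real `t`), is smooth, and satisfies the fourth order ODE
`tu'''' + 5u''' − t(5t²+8N−4)u'' − (36t²+20N−10)u'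
  + t(4t⁴+(20N−10)t²+16N²−16N−44)u = 0`. -/
theorem goeEGF_ode (N : ℕ) (hN : 2 ≤ N) :
    (∀ t : ℝ, Integrable (fun x : ℝ => Real.exp (t * x) * goeDensity N x)) ∧
    ContDiff ℝ (⊤ : ℕ∞) (goeEGF N) ∧
    ∀ t : ℝ,
      t * iteratedDeriv 4 (goeEGF N) t + 5 * iteratedDeriv 3 (goeEGF N) t -
          t * (5 * t ^ 2 + 8 * (N : ℝ) - 4) * iteratedDeriv 2 (goeEGF N) t -
          (36 * t ^ 2 + 20 * (N : ℝ) - 10) * deriv (goeEGF N) t +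
          t * (4 * t ^ 4 + (20 * (N : ℝ) - 10) * t ^ 2 + 16 * (N : ℝ) ^ 2 - 16 * (N : ℝ) - 44) *
            goeEGF N t = 0 := by
  obtain ⟨n, rfl⟩ : ∃ n, N = n + 1 := ⟨N - 1, by omega⟩
  have hA := rapidDecay_waveFun (n + 1)
  have hB := rapidDecay_waveFun n
  have hQ : ExpGrowth (fun x => 1 / 2 * qFun (n + 1) x + Aconst (n + 1)) :=
    ((ExpGrowth.const (1 / 2)).mul
      (.of_bounded (continuous_qFun _) _ (abs_qFun_le (n + 1)))).add (.const _)
  have hu : goeEGF (n + 1) = bilateralLaplace (goeDensity (n + 1)) := rfl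
  have hρ : RapidDecay (goeDensity (n + 1)) := by
    rw [goeDensity_succ]
    exact rapidDecay_densityForm hA hB hQ
  refine ⟨hρ.integrable_exp_mul, hu ▸ contDiff_bilateralLaplace hρ, fun t => ?_⟩
  have key := bilateralLaplace_densityForm_ode hA hB hQ (hasDerivAt_waveFun_succ n)
    (hasDerivAt_waveFun n)
    (fun x => by
      refine (((hasDerivAt_qFun (n + 1) x).const_mul (1 / 2)).add_const
        (Aconst (n + 1))).congr_deriv ?_
      ring) t
  rw [Real.sq_sqrt (Nat.cast_nonneg _), ← goeDensity_succ, ← hu] at key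
  linear_combination key
end
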